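/- arXiv:2006.08160 — 2 statements merged into one kernel-verified Lean document; each statement's English description precedes it below -/
import Mathlib

section
/- Let X ~ N(θ, Σ) with Σ positive definite and d > 2. Then E[(X-θ)ᵀΣ⁻¹X / (XᵀΣ⁻¹X)] = (d-2) E[1/(XᵀΣ⁻¹X)]. -/
open MeasureTheory ProbabilityTheory Matrix

/-- A random vector `X` has the multivariate Gaussian law `N(θ, C)` under `μ` iff every
linear functional of `X` has the corresponding one-dimensional Gaussian law. -/
def HasGaussianLaw {Ω ι : Type*} [Fintype ι] [MeasurableSpace Ω] (μ : Measure Ω)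
    (X : Ω → ι → ℝ) (θ : ι → ℝ) (C : Matrix ι ι ℝ) : Prop :=
  ∀ a : ι → ℝ, Measure.map (fun ω => a ⬝ᵥ X ω) μ =
    gaussianReal (a ⬝ᵥ θ) (Real.toNNReal (a ⬝ᵥ C.mulVec a))

lemma integrable_gaussianReal_one_iff (m : ℝ) (f : ℝ → ℝ) :
    Integrable f (gaussianReal m 1) ↔ Integrable (fun t => gaussianPDFReal m 1 t * f t) := by
  rw [gaussianReal_of_var_ne_zero _ one_ne_zero,
    integrable_withDensity_iff_integrable_smul' (measurable_gaussianPDF m 1)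
      (ae_of_all _ fun _ => gaussianPDF_lt_top)]
  simp [toReal_gaussianPDF]

lemma gaussianPDFReal_one_le_one (m t : ℝ) : gaussianPDFReal m 1 t ≤ 1 := by
  rw [gaussianPDFReal_def]
  have h1 : 1 ≤ √(2 * Real.pi * ((1 : NNReal) : ℝ)) := by
    rw [Real.one_le_sqrt]
    simp
    nlinarith [Real.pi_gt_three]
  refine mul_le_one₀ (inv_le_one_of_one_le₀ h1) (Real.exp_nonneg _) ?_
  rw [Real.exp_le_one_iff, neg_div, neg_nonpos]
  positivity

/-- A negative power of `|t|` of exponent greater than `-1` is integrable under a Gaussian law. -/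
lemma integrable_abs_rpow_gaussianReal (m : ℝ) {r : ℝ} (hr : -1 < r) (hr0 : r ≤ 0) :
    Integrable (fun t : ℝ => |t| ^ r) (gaussianReal m 1) := by
  have hpos : IntegrableOn (fun t : ℝ => |t| ^ r) (Set.Ioc 0 1) := by
    have h := (intervalIntegral.intervalIntegrable_rpow' hr (a := 0) (b := 1)).1
    exact h.congr_fun (fun t ht => by simp [abs_of_pos ht.1]) measurableSet_Ioc
  have hneg : IntegrableOn (fun t : ℝ => |t| ^ r) (Set.Ico (-1) 0) := by
    have h := hpos.comp_neg
    simpa using h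
  have hI : IntegrableOn (fun t : ℝ => |t| ^ r) (Set.Icc (-1) 1) := by
    have h0 : IntegrableOn (fun t : ℝ => |t| ^ r) {0} := by simp
    refine ((hneg.union h0).union hpos).mono_set fun t ht => ?_
    rcases lt_trichotomy t 0 with h | h | h
    · exact Or.inl (Or.inl ⟨ht.1, h⟩)
    · exact Or.inl (Or.inr h)
    · exact Or.inr ⟨h, ht.2⟩
  rw [integrable_gaussianReal_one_iff]
  have hb := (hI.integrable_indicator measurableSet_Icc).add (integrable_gaussianPDFReal m 1)
  refine hb.mono' ((measurable_gaussianPDFReal m 1).mul (by fun_prop)).aestronglyMeasurable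
    (ae_of_all _ fun t => ?_)
  have hg := gaussianPDFReal_nonneg m 1 t
  have ha : 0 ≤ |t| ^ r := by positivity
  rw [Real.norm_of_nonneg (by positivity)]
  by_cases ht : t ∈ Set.Icc (-1 : ℝ) 1
  · simp only [Pi.add_apply, Set.indicator_of_mem ht]
    nlinarith [gaussianPDFReal_one_le_one m t]
  · simp only [Pi.add_apply, Set.indicator_of_notMem ht]
    have : 1 ≤ |t| := by
      by_contra! h
      exact ht (abs_le.1 h.le)
    nlinarith [Real.rpow_le_one_of_one_le_of_nonpos this hr0]

lemma hasDerivAt_gaussianPDFReal_one (m t : ℝ) :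
    HasDerivAt (gaussianPDFReal m 1) (-(t - m) * gaussianPDFReal m 1 t) t := by
  rw [gaussianPDFReal_def]
  have h : HasDerivAt (fun x : ℝ => -(x - m) ^ 2 / (2 * ((1 : NNReal) : ℝ))) (-(t - m)) t := by
    have := ((((hasDerivAt_id t).sub_const m).pow 2).neg).div_const (2 * ((1 : NNReal) : ℝ))
    refine this.congr_deriv ?_
    simp
    ring
  refine (h.exp.const_mul _).congr_deriv ?_
  ring

/-- Stein's identity for a one-dimensional Gaussian law of unit variance. -/
lemma integral_sub_mul_gaussianReal_one (m : ℝ) {g g' : ℝ → ℝ}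
    (hg : ∀ t, HasDerivAt g (g' t) t) (hgi : Integrable g (gaussianReal m 1))
    (hmi : Integrable (fun t => (t - m) * g t) (gaussianReal m 1))
    (hgi' : Integrable g' (gaussianReal m 1)) :
    ∫ t, (t - m) * g t ∂gaussianReal m 1 = ∫ t, g' t ∂gaussianReal m 1 := by
  have h := integral_eq_zero_of_hasDerivAt_of_integrable
    (f := fun t => gaussianPDFReal m 1 t * g t)
    (f' := fun t => gaussianPDFReal m 1 t * (g' t - (t - m) * g t))
    (fun t => ((hasDerivAt_gaussianPDFReal_one m t).mul (hg t)).congr_deriv (by ring))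
    ((integrable_gaussianReal_one_iff m (fun t => g' t - (t - m) * g t)).1 (hgi'.sub hmi))
    ((integrable_gaussianReal_one_iff m g).1 hgi)
  have h2 : ∫ t, (g' t - (t - m) * g t) ∂gaussianReal m 1 = 0 := by
    rw [integral_gaussianReal_eq_integral_smul one_ne_zero]
    simpa using h
  rw [integral_sub hgi' hmi] at h2
  linarith

lemma ae_pi_gaussianReal_ne_zero {ι : Type*} [Fintype ι] (m : ι → ℝ) :
    ∀ᵐ y ∂Measure.pi (fun i => gaussianReal (m i) 1), ∀ i, y i ≠ 0 := by
  rw [ae_all_iff]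
  intro i
  have : NullSingletonClass (gaussianReal (m i) 1) := nullSingletonClass_gaussianReal one_ne_zero
  exact Measure.ae_eval_ne (μ := fun i => gaussianReal (m i) 1) i 0

/-- In dimension greater than two, the inverse squared norm is integrable under a Gaussian law
with identity covariance. -/
lemma integrable_inv_sum_sq_pi_gaussianReal {ι : Type*} [Fintype ι] (hι : 2 < Fintype.card ι)
    (m : ι → ℝ) :
    Integrable (fun y : ι → ℝ => (∑ i, y i ^ 2)⁻¹)
      (Measure.pi fun i => gaussianReal (m i) 1) := by
  set n : ℝ := (Fintype.card ι : ℝ) with hn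
  have hn2 : 2 < n := by rw [hn]; exact_mod_cast hι
  have hr : -1 < -(2 / n) := by
    rw [neg_lt_neg_iff, div_lt_one (by linarith)]; exact hn2
  have hprod : Integrable (fun y : ι → ℝ => ∏ i, |y i| ^ (-(2 / n)))
      (Measure.pi fun i => gaussianReal (m i) 1) :=
    Integrable.fintype_prod (f := fun _ t => |t| ^ (-(2 / n))) fun i =>
      integrable_abs_rpow_gaussianReal (m i) hr (by rw [neg_nonpos]; positivity)
  refine hprod.mono' (Measurable.aestronglyMeasurable (by fun_prop)) ?_
  filter_upwards [ae_pi_gaussianReal_ne_zero m] with y hy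
  rw [Real.norm_of_nonneg (inv_nonneg.2 (Finset.sum_nonneg fun i _ => sq_nonneg _))]
  have hprod_eq : ∏ i, |y i| ^ (-(2 / n)) = (∏ i, (y i ^ 2) ^ (1 / n))⁻¹ := by
    rw [← Finset.prod_inv_distrib]
    refine Finset.prod_congr rfl fun i _ => ?_
    rw [Real.rpow_neg (abs_nonneg _), ← sq_abs, ← Real.rpow_natCast, ← Real.rpow_mul (abs_nonneg _)]
    congr 2
    push_cast
    ring
  rw [hprod_eq]
  refine inv_anti₀ (Finset.prod_pos fun i _ => Real.rpow_pos_of_pos (sq_pos_of_ne_zero (hy i)) _) ?_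
  have hw : ∑ _i : ι, 1 / n = 1 := by
    simp [← hn]; field_simp
  refine (Real.geom_mean_le_arith_mean_weighted Finset.univ (fun _ => 1 / n) (fun i => y i ^ 2)
    (fun _ _ => by positivity) hw (fun _ _ => sq_nonneg _)).trans
    (Finset.sum_le_sum fun i _ => ?_)
  refine mul_le_of_le_one_left (sq_nonneg _) ?_
  rw [div_le_one (by linarith)]
  linarith

lemma abs_div_le_one_add_inv {t s : ℝ} (hs : 0 < s) (hts : t ^ 2 ≤ s) : |t / s| ≤ 1 + s⁻¹ := by
  rw [abs_div, abs_of_pos hs, div_le_iff₀ hs, add_mul, inv_mul_cancel₀ hs.ne']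
  nlinarith [sq_abs t, sq_nonneg (|t| - 1)]

lemma abs_sub_mul_div_le {t s : ℝ} (m : ℝ) (hs : 0 < s) (hts : t ^ 2 ≤ s) :
    |(t - m) * (t / s)| ≤ 1 + |m| * (1 + s⁻¹) := by
  have h : (t - m) * (t / s) = t ^ 2 / s - m * (t / s) := by ring
  rw [h]
  refine (abs_sub _ _).trans (add_le_add ?_ ?_)
  · rw [abs_of_nonneg (by positivity), div_le_one hs]
    exact hts
  · rw [abs_mul]
    exact mul_le_mul_of_nonneg_left (abs_div_le_one_add_inv hs hts) (abs_nonneg m)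

lemma abs_inv_sub_two_mul_sq_mul_le {t s : ℝ} (hs : 0 < s) (hts : t ^ 2 ≤ s) :
    |s⁻¹ - 2 * t ^ 2 * s⁻¹ ^ 2| ≤ 3 * s⁻¹ := by
  have h1 : 0 < s⁻¹ := inv_pos.2 hs
  have h2 : t ^ 2 * s⁻¹ ≤ 1 := by
    rw [← div_eq_mul_inv, div_le_one hs]
    exact hts
  have h3 : t ^ 2 * s⁻¹ * s⁻¹ ≤ 1 * s⁻¹ := mul_le_mul_of_nonneg_right h2 h1.le
  have h4 : 0 ≤ t ^ 2 * s⁻¹ * s⁻¹ := by positivity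
  rw [abs_le]
  constructor <;> nlinarith

lemma integral_sub_mul_div_sq_add_gaussianReal (m : ℝ) {a : ℝ} (ha : 0 < a) :
    ∫ t, (t - m) * (t / (t ^ 2 + a)) ∂gaussianReal m 1 =
      ∫ t, ((t ^ 2 + a)⁻¹ - 2 * t ^ 2 * (t ^ 2 + a)⁻¹ ^ 2) ∂gaussianReal m 1 := by
  have hs (t : ℝ) : 0 < t ^ 2 + a := by positivity
  have hts (t : ℝ) : t ^ 2 ≤ t ^ 2 + a := by linarith
  have hinv (t : ℝ) : (t ^ 2 + a)⁻¹ ≤ a⁻¹ := inv_anti₀ ha (by nlinarith)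
  refine integral_sub_mul_gaussianReal_one m (fun t => ?_) ?_ ?_ ?_
  · have h := (hasDerivAt_id t).div (((hasDerivAt_id t).pow 2).add_const a) (hs t).ne'
    refine h.congr_deriv ?_
    have := (hs t).ne'
    simp
    field_simp
  · refine Integrable.of_bound (Measurable.aestronglyMeasurable (by fun_prop)) (1 + a⁻¹)
      (ae_of_all _ fun t => ?_)
    exact (abs_div_le_one_add_inv (hs t) (hts t)).trans (by have := hinv t; gcongr)
  · refine Integrable.of_bound (Measurable.aestronglyMeasurable (by fun_prop))
      (1 + |m| * (1 + a⁻¹)) (ae_of_all _ fun t => ?_)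
    exact (abs_sub_mul_div_le m (hs t) (hts t)).trans (by have := hinv t; gcongr)
  · refine Integrable.of_bound (Measurable.aestronglyMeasurable (by fun_prop)) (3 * a⁻¹)
      (ae_of_all _ fun t => ?_)
    exact (abs_inv_sub_two_mul_sq_mul_le (hs t) (hts t)).trans (by have := hinv t; gcongr)

section

variable {ι : Type*} [Fintype ι]

lemma ae_pi_gaussianReal_sum_sq_pos [Nonempty ι] (m : ι → ℝ) :
    ∀ᵐ y ∂Measure.pi (fun i => gaussianReal (m i) 1), 0 < ∑ i, y i ^ 2 := by
  filter_upwards [ae_pi_gaussianReal_ne_zero m] with y hy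
  exact Finset.sum_pos (fun i _ => sq_pos_of_ne_zero (hy i)) Finset.univ_nonempty

lemma integrable_sub_mul_div_sum_sq_pi_gaussianReal (hι : 2 < Fintype.card ι) (m : ι → ℝ) (i : ι) :
    Integrable (fun y : ι → ℝ => (y i - m i) * (y i / ∑ j, y j ^ 2))
      (Measure.pi fun i => gaussianReal (m i) 1) := by
  have : Nonempty ι := ⟨i⟩
  refine Integrable.mono' ((integrable_const 1).add
    (((integrable_const 1).add (integrable_inv_sum_sq_pi_gaussianReal hι m)).const_mul |m i|))
    (Measurable.aestronglyMeasurable (by fun_prop)) ?_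
  filter_upwards [ae_pi_gaussianReal_sum_sq_pos m] with y hy
  exact abs_sub_mul_div_le (m i) hy
    (Finset.single_le_sum (f := fun j => y j ^ 2) (fun j _ => sq_nonneg _) (Finset.mem_univ i))

lemma integrable_inv_sum_sq_sub_pi_gaussianReal (hι : 2 < Fintype.card ι) (m : ι → ℝ) (i : ι) :
    Integrable (fun y : ι → ℝ => (∑ j, y j ^ 2)⁻¹ - 2 * y i ^ 2 * (∑ j, y j ^ 2)⁻¹ ^ 2)
      (Measure.pi fun i => gaussianReal (m i) 1) := by
  have : Nonempty ι := ⟨i⟩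
  refine Integrable.mono' ((integrable_inv_sum_sq_pi_gaussianReal hι m).const_mul 3)
    (Measurable.aestronglyMeasurable (by fun_prop)) ?_
  filter_upwards [ae_pi_gaussianReal_sum_sq_pos m] with y hy
  exact abs_inv_sub_two_mul_sq_mul_le hy
    (Finset.single_le_sum (f := fun j => y j ^ 2) (fun j _ => sq_nonneg _) (Finset.mem_univ i))

end

lemma integral_sub_mul_div_sum_sq_pi_gaussianReal {n : ℕ} (hn : 2 < n + 1) (m : Fin (n + 1) → ℝ)
    (i : Fin (n + 1)) :
    ∫ y, (y i - m i) * (y i / ∑ j, y j ^ 2) ∂(Measure.pi fun i => gaussianReal (m i) 1) =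
      ∫ y, ((∑ j, y j ^ 2)⁻¹ - 2 * y i ^ 2 * (∑ j, y j ^ 2)⁻¹ ^ 2)
        ∂(Measure.pi fun i => gaussianReal (m i) 1) := by
  have hmp := measurePreserving_piFinSuccAbove (fun i => gaussianReal (m i) 1) i
  have hemb := (MeasurableEquiv.piFinSuccAbove (fun _ : Fin (n + 1) => ℝ) i).measurableEmbedding
  have : Nonempty (Fin n) := ⟨⟨0, by lia⟩⟩
  have hcard : 2 < Fintype.card (Fin (n + 1)) := by simpa using hn
  let F : ℝ × (Fin n → ℝ) → ℝ := fun p => (p.1 - m i) * (p.1 / (p.1 ^ 2 + ∑ j, p.2 j ^ 2))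
  let G : ℝ × (Fin n → ℝ) → ℝ := fun p =>
    (p.1 ^ 2 + ∑ j, p.2 j ^ 2)⁻¹ - 2 * p.1 ^ 2 * (p.1 ^ 2 + ∑ j, p.2 j ^ 2)⁻¹ ^ 2
  have hF := integrable_sub_mul_div_sum_sq_pi_gaussianReal hcard m i
  have hG := integrable_inv_sum_sq_sub_pi_gaussianReal hcard m i
  simp only [Fin.sum_univ_succAbove _ i] at hF hG ⊢
  calc
    _ = ∫ p, F p ∂((gaussianReal (m i) 1).prod
          (Measure.pi fun j => gaussianReal (m (i.succAbove j)) 1)) := hmp.integral_comp' F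
    _ = ∫ p, G p ∂((gaussianReal (m i) 1).prod
          (Measure.pi fun j => gaussianReal (m (i.succAbove j)) 1)) := by
      rw [integral_prod_symm F ((hmp.integrable_comp_emb hemb).1 hF),
        integral_prod_symm G ((hmp.integrable_comp_emb hemb).1 hG)]
      refine integral_congr_ae ?_
      filter_upwards [ae_pi_gaussianReal_sum_sq_pos fun j => m (i.succAbove j)] with z hz
      exact integral_sub_mul_div_sq_add_gaussianReal (m i) hz
    _ = _ := (hmp.integral_comp' G).symm

/-- Stein's identity for the field `y / ‖y‖²` under a Gaussian law with identity covariance. -/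
lemma integral_sum_sub_mul_div_sum_sq_pi_gaussianReal {d : ℕ} (hd : 2 < d) (m : Fin d → ℝ) :
    ∫ y, (∑ i, (y i - m i) * y i) / (∑ j, y j ^ 2) ∂(Measure.pi fun i => gaussianReal (m i) 1) =
      ((d : ℝ) - 2) * ∫ y, (∑ j, y j ^ 2)⁻¹ ∂(Measure.pi fun i => gaussianReal (m i) 1) := by
  obtain ⟨n, rfl⟩ : ∃ n, d = n + 1 := ⟨d - 1, by lia⟩
  have hcard : 2 < Fintype.card (Fin (n + 1)) := by simpa using hd
  simp only [Finset.sum_div, mul_div_assoc]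
  rw [integral_finsetSum _ fun i _ => integrable_sub_mul_div_sum_sq_pi_gaussianReal hcard m i]
  simp only [integral_sub_mul_div_sum_sq_pi_gaussianReal hd m]
  rw [← integral_finsetSum _ fun i _ => integrable_inv_sum_sq_sub_pi_gaussianReal hcard m i,
    ← integral_const_mul]
  refine integral_congr_ae ?_
  filter_upwards [ae_pi_gaussianReal_sum_sq_pos m] with y hy
  rw [Finset.sum_sub_distrib, ← Finset.sum_mul, ← Finset.mul_sum, Finset.sum_const,
    Finset.card_univ, Fintype.card_fin, nsmul_eq_mul]
  field_simp

open scoped MatrixOrder in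
lemma Matrix.PosDef.exists_whitening {ι : Type*} [Fintype ι] [DecidableEq ι] {S : Matrix ι ι ℝ}
    (hS : S.PosDef) : ∃ B : Matrix ι ι ℝ, S⁻¹ = Bᵀ * B ∧ B * S * Bᵀ = 1 := by
  obtain ⟨B, hB⟩ := CStarAlgebra.nonneg_iff_eq_star_mul_self.mp hS.inv.posSemidef.nonneg
  rw [star_eq_conjTranspose, conjTranspose_eq_transpose_of_trivial] at hB
  refine ⟨B, hB, ?_⟩
  have h : Bᵀ * (B * S) = 1 := by
    rw [← Matrix.mul_assoc, ← hB, Matrix.nonsing_inv_mul _ hS.det_pos.ne'.isUnit]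
  exact mul_eq_one_comm.1 h

lemma aemeasurable_of_forall_map_dotProduct {Ω ι : Type*} [Fintype ι] [DecidableEq ι]
    [MeasurableSpace Ω] {μ : Measure Ω} {X : Ω → ι → ℝ}
    (hX : ∀ a : ι → ℝ, IsProbabilityMeasure (Measure.map (fun ω => a ⬝ᵥ X ω) μ)) :
    AEMeasurable X μ := by
  refine aemeasurable_pi_lambda _ fun i => ?_
  have := hX (Pi.single i 1)
  have h := AEMeasurable.of_map_ne_zero
    (IsProbabilityMeasure.ne_zero (Measure.map (fun ω => Pi.single i 1 ⬝ᵥ X ω) μ))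
  simpa using h

/-- Linear whitening turns a Gaussian law into a product of unit variance ones. -/
lemma map_mulVec_eq_pi_gaussianReal {Ω ι : Type*} [Fintype ι] [DecidableEq ι] [MeasurableSpace Ω]
    {μ : Measure Ω} [IsProbabilityMeasure μ] {X : Ω → ι → ℝ} {θ : ι → ℝ} {S : Matrix ι ι ℝ}
    (hXm : AEMeasurable X μ)
    (hX : ∀ a : ι → ℝ, Measure.map (fun ω => a ⬝ᵥ X ω) μ =
      gaussianReal (a ⬝ᵥ θ) (Real.toNNReal (a ⬝ᵥ S.mulVec a)))
    {B : Matrix ι ι ℝ} (hB : B * S * Bᵀ = 1) :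
    Measure.map (fun ω => B *ᵥ X ω) μ =
      Measure.pi fun i => gaussianReal ((B *ᵥ θ) i) 1 := by
  have hY : AEMeasurable (fun ω => B *ᵥ X ω) μ :=
    (Continuous.measurable (by fun_prop : Continuous fun x : ι → ℝ => B *ᵥ x)).comp_aemeasurable hXm
  have := Measure.isProbabilityMeasure_map hY
  refine charFunDual_eq_pi_iff.1 fun L => ?_
  set c : ι → ℝ := fun i => L (Pi.single i 1) with hc
  have hL (y : ι → ℝ) : L y = c ⬝ᵥ y := by
    conv_lhs => rw [pi_eq_sum_univ' y]
    simp [dotProduct, hc, mul_comm]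
  have hmap : (Measure.map (fun ω => B *ᵥ X ω) μ).map L =
      gaussianReal (c ⬝ᵥ B *ᵥ θ) (Real.toNNReal (c ⬝ᵥ c)) := by
    rw [AEMeasurable.map_map_of_aemeasurable (by fun_prop) hY]
    have h := hX (c ᵥ* B)
    have hv : (c ᵥ* B) ⬝ᵥ S *ᵥ (c ᵥ* B) = c ⬝ᵥ c := by
      rw [← dotProduct_mulVec, ← mulVec_transpose, mulVec_mulVec, mulVec_mulVec,
        hB, one_mulVec]
    rw [hv, ← dotProduct_mulVec] at h
    rw [← h]
    congr 1
    ext ω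
    rw [Function.comp_apply, hL, dotProduct_mulVec]
  have hfac (i : ι) : charFunDual (gaussianReal ((B *ᵥ θ) i) 1) (L.comp (.single ℝ (fun _ => ℝ) i)) =
      charFun (gaussianReal ((B *ᵥ θ) i) 1) (c i) := by
    rw [charFunDual_apply, charFun_apply_real]
    congr with t
    simp [hL]
  have hcc : 0 ≤ c ⬝ᵥ c := Finset.sum_nonneg fun i _ => mul_self_nonneg _
  rw [charFunDual_eq_charFun_map_one, hmap]
  simp only [hfac, charFun_gaussianReal]
  rw [← Complex.exp_sum, Real.coe_toNNReal _ hcc]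
  congr 1
  simp only [dotProduct, Finset.sum_sub_distrib, ← Finset.sum_mul, ← Finset.sum_div]
  push_cast
  simp only [one_mul, mul_one, pow_two]

/-- Stein-type identity: for `X ~ N(θ, Σ)` with `Σ` positive definite and `d > 2`,
`E[(X-θ)ᵀSig⁻¹X / (XᵀSig⁻¹X)] = (d-2) E[1/(XᵀSig⁻¹X)]`. -/
theorem stmt_7 {d : ℕ} (hd : 2 < d) {Ω : Type*} [MeasurableSpace Ω]
    (μ : Measure Ω) [IsProbabilityMeasure μ]
    (θ : Fin d → ℝ) (Sig : Matrix (Fin d) (Fin d) ℝ) (hSig : Sig.PosDef)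
    (X : Ω → Fin d → ℝ) (hX : HasGaussianLaw μ X θ Sig) :
    ∫ ω, ((X ω - θ) ⬝ᵥ (Sig⁻¹ *ᵥ X ω)) / (X ω ⬝ᵥ (Sig⁻¹ *ᵥ X ω)) ∂μ =
      ((d : ℝ) - 2) * ∫ ω, (X ω ⬝ᵥ (Sig⁻¹ *ᵥ X ω))⁻¹ ∂μ := by
  have hXm : AEMeasurable X μ := aemeasurable_of_forall_map_dotProduct fun a => by
    rw [hX a]; infer_instance
  obtain ⟨B, hinv, hone⟩ := hSig.exists_whitening
  have hlaw := map_mulVec_eq_pi_gaussianReal hXm hX hone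
  have hY : AEMeasurable (fun ω => B *ᵥ X ω) μ :=
    (Continuous.measurable
      (by fun_prop : Continuous fun x : Fin d → ℝ => B *ᵥ x)).comp_aemeasurable hXm
  have hquad (u v : Fin d → ℝ) : u ⬝ᵥ (Sig⁻¹ *ᵥ v) = ∑ i, (B *ᵥ u) i * (B *ᵥ v) i := by
    rw [hinv, ← mulVec_mulVec, dotProduct_mulVec, vecMul_transpose]
    rfl
  have h := integral_sum_sub_mul_div_sum_sq_pi_gaussianReal hd (B *ᵥ θ)
  rw [← hlaw, integral_map hY (Measurable.aestronglyMeasurable (by fun_prop)),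
    integral_map hY (Measurable.aestronglyMeasurable (by fun_prop))] at h
  simpa only [hquad, mulVec_sub, Pi.sub_apply, ← pow_two] using h
end

section
/- For d > 2, the James–Stein estimator θ̂(X) = (1 - (d-2)/(XᵀΣ⁻¹X)) X satisfies E[(θ̂ - θ)ᵀΣ⁻¹(θ̂ - θ)] < d = E[(X - θ)ᵀΣ⁻¹(X - θ)] for every θ ∈ ℝ^d, i.e. it strictly dominates the estimator X. -/
open MeasureTheory ProbabilityTheory Matrix

lemma integrable_gaussianReal_iff {m : ℝ} {v : NNReal} (hv : v ≠ 0) {f : ℝ → ℝ} :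
    Integrable f (gaussianReal m v) ↔ Integrable fun x => gaussianPDFReal m v x * f x := by
  rw [gaussianReal_of_var_ne_zero _ hv, integrable_withDensity_iff_integrable_smul'
    (measurable_gaussianPDF _ _) (ae_of_all _ fun _ => gaussianPDF_lt_top)]
  simp [toReal_gaussianPDF]

/-- **Stein's identity** for a bounded function with bounded derivative. -/
lemma integral_sub_mul_gaussianReal {m C C' : ℝ} {f f' : ℝ → ℝ}
    (hf : ∀ x, HasDerivAt f (f' x) x) (hC : ∀ x, |f x| ≤ C) (hC' : ∀ x, |f' x| ≤ C') :
    ∫ x, (x - m) * f x ∂gaussianReal m 1 = ∫ x, f' x ∂gaussianReal m 1 := by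
  have hfm : Measurable f := (continuous_iff_continuousAt.2 fun x => (hf x).continuousAt).measurable
  have hf'm : Measurable f' := by
    have : f' = deriv f := funext fun x => (hf x).deriv.symm
    rw [this]; exact measurable_deriv f
  have hi : Integrable f (gaussianReal m 1) :=
    Integrable.of_bound hfm.aestronglyMeasurable C (ae_of_all _ hC)
  have hi' : Integrable f' (gaussianReal m 1) :=
    Integrable.of_bound hf'm.aestronglyMeasurable C' (ae_of_all _ hC')
  have hid : Integrable (fun x => x - m) (gaussianReal m 1) :=
    ((memLp_id_gaussianReal (μ := m) (v := 1) 1).integrable (by simp)).sub (integrable_const m)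
  have hmul : Integrable (fun x => (x - m) * f x) (gaussianReal m 1) :=
    hid.mul_bdd hfm.aestronglyMeasurable (ae_of_all _ hC)
  have hsub := hi'.sub hmul
  have hderiv : ∀ x, HasDerivAt (fun x => gaussianPDFReal m 1 x * f x)
      (gaussianPDFReal m 1 x * (f' x - (x - m) * f x)) x := by
    intro x
    have h1 : HasDerivAt (gaussianPDFReal m 1) (-(x - m) * gaussianPDFReal m 1 x) x := by
      rw [gaussianPDFReal_def]
      have h2 : HasDerivAt (fun x : ℝ => -(x - m) ^ 2 / (2 * ((1 : NNReal) : ℝ))) (-(x - m)) x := by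
        have := ((((hasDerivAt_id x).sub_const m).pow 2).neg).div_const (2 * ((1 : NNReal) : ℝ))
        exact this.congr_deriv (by simp; ring)
      exact (h2.exp.const_mul _).congr_deriv (by ring)
    exact (h1.mul (hf x)).congr_deriv (by ring)
  have hz := integral_eq_zero_of_hasDerivAt_of_integrable hderiv
    ((integrable_gaussianReal_iff one_ne_zero).1 hsub)
    ((integrable_gaussianReal_iff one_ne_zero).1 hi)
  have h3 := integral_gaussianReal_eq_integral_smul (μ := m) (v := 1)
    (f := fun x => f' x - (x - m) * f x) one_ne_zero
  simp only [smul_eq_mul] at h3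
  rw [hz, integral_sub hi' hmul] at h3
  linarith

/-- The Gaussian measure on `ℝ^d` with mean `m` and identity covariance. -/
noncomputable def piGaussian {d : ℕ} (m : Fin d → ℝ) : Measure (Fin d → ℝ) :=
  Measure.pi fun i => gaussianReal (m i) 1

instance {d : ℕ} (m : Fin d → ℝ) : IsProbabilityMeasure (piGaussian m) := by
  unfold piGaussian; infer_instance

lemma measurePreserving_eval_piGaussian {d : ℕ} (m : Fin d → ℝ) (i : Fin d) :
    MeasurePreserving (fun z : Fin d → ℝ => z i) (piGaussian m) (gaussianReal (m i) 1) :=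
  measurePreserving_eval (fun i => gaussianReal (m i) 1) i

lemma memLp_eval_piGaussian {d : ℕ} (m : Fin d → ℝ) (i : Fin d) :
    MemLp (fun z : Fin d → ℝ => z i) 2 (piGaussian m) :=
  (memLp_id_gaussianReal (μ := m i) (v := 1) 2).comp_measurePreserving
    (measurePreserving_eval_piGaussian m i)

/-- Stein's identity in one coordinate of a standard Gaussian vector. -/
lemma integral_sub_mul_piGaussian {d : ℕ} (m : Fin d → ℝ) (i : Fin d) {C C' : ℝ}
    {F F' : (Fin d → ℝ) → ℝ} (hF : Measurable F) (hF' : Measurable F')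
    (hd : ∀ z t, HasDerivAt (fun t => F (Function.update z i t)) (F' (Function.update z i t)) t)
    (hC : ∀ z, |F z| ≤ C) (hC' : ∀ z, |F' z| ≤ C') :
    ∫ z, (z i - m i) * F z ∂piGaussian m = ∫ z, F' z ∂piGaussian m := by
  obtain _ | n := d
  · exact i.elim0
  have e := (measurePreserving_piFinSuccAbove (fun i => gaussianReal (m i) 1) i).symm
  have hint : Integrable (fun z => (z i - m i) * F z) (piGaussian m) :=
    (((memLp_eval_piGaussian m i).integrable (by norm_num)).sub (integrable_const _)).mul_bdd
      hF.aestronglyMeasurable (ae_of_all _ hC)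
  have hint' : Integrable F' (piGaussian m) :=
    Integrable.of_bound hF'.aestronglyMeasurable C' (ae_of_all _ hC')
  unfold piGaussian at *
  rw [← e.integrable_comp_emb (MeasurableEquiv.measurableEmbedding _)] at hint hint'
  simp only [Function.comp_def] at hint hint'
  rw [← e.integral_comp', ← e.integral_comp', integral_prod_symm _ hint,
    integral_prod_symm _ hint']
  congr 1
  ext y
  simp only [MeasurableEquiv.piFinSuccAbove_symm_apply, Fin.insertNthEquiv, Equiv.coe_fn_mk,
    Fin.insertNth_apply_same]
  refine integral_sub_mul_gaussianReal (C := C) (C' := C') (fun x => ?_) (fun x => hC _)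
    (fun x => hC' _)
  have := hd (i.insertNth 0 y) x
  simpa using this

lemma ae_dotProduct_self_pos_piGaussian {d : ℕ} (hd : 0 < d) (m : Fin d → ℝ) :
    ∀ᵐ z ∂piGaussian m, 0 < z ⬝ᵥ z := by
  have : ∀ᵐ x ∂gaussianReal (m ⟨0, hd⟩) 1, x ≠ 0 := by
    have := nullSingletonClass_gaussianReal (μ := m ⟨0, hd⟩) (v := 1) one_ne_zero
    simp [ae_iff]
  have h2 := (measurePreserving_eval_piGaussian m ⟨0, hd⟩).quasiMeasurePreserving.ae this
  filter_upwards [h2] with z hz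
  have h0 : z ≠ 0 := fun h => hz (by simp [h])
  exact lt_of_le_of_ne (Finset.sum_nonneg fun i _ => mul_self_nonneg _)
    (Ne.symm (by simpa using h0))

lemma measurable_dotProduct_self {d : ℕ} : Measurable fun z : Fin d → ℝ => z ⬝ᵥ z := by
  unfold dotProduct; fun_prop

lemma measurable_sub_dotProduct {d : ℕ} (m : Fin d → ℝ) :
    Measurable fun z : Fin d → ℝ => (z - m) ⬝ᵥ z := by
  simp only [dotProduct, Pi.sub_apply]; fun_prop

lemma real_dotProduct_self_nonneg {d : ℕ} (z : Fin d → ℝ) : 0 ≤ z ⬝ᵥ z :=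
  Finset.sum_nonneg fun _ _ => mul_self_nonneg _

lemma sq_le_dotProduct_self {d : ℕ} (z : Fin d → ℝ) (i : Fin d) : z i ^ 2 ≤ z ⬝ᵥ z := by
  rw [sq]
  exact Finset.single_le_sum (f := fun i => z i * z i) (fun _ _ => mul_self_nonneg _)
    (Finset.mem_univ i)

lemma dotProduct_update_self {d : ℕ} (z : Fin d → ℝ) (i : Fin d) (t : ℝ) :
    Function.update z i t ⬝ᵥ Function.update z i t = t ^ 2 + (z ⬝ᵥ z - z i ^ 2) := by
  simp only [dotProduct]
  rw [← Finset.add_sum_erase _ _ (Finset.mem_univ i),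
    ← Finset.add_sum_erase _ (fun j => z j * z j) (Finset.mem_univ i)]
  rw [Finset.sum_congr rfl fun j hj => by
    rw [Function.update_of_ne (Finset.ne_of_mem_erase hj)]]
  simp; ring

section Regularized

variable {d : ℕ} (m : Fin d → ℝ) {ε : ℝ}

lemma abs_coord_div_le (hε : 0 < ε) (z : Fin d → ℝ) (i : Fin d) :
    |z i / (z ⬝ᵥ z + ε)| ≤ 1 + 1 / ε := by
  have hs := real_dotProduct_self_nonneg z
  have hi := sq_le_dotProduct_self z i
  rw [abs_div, abs_of_pos (by positivity : 0 < z ⬝ᵥ z + ε), div_le_iff₀ (by positivity)]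
  have h1 : |z i| ≤ 1 + z ⬝ᵥ z := by
    rw [abs_le]; constructor <;> nlinarith [sq_nonneg (z i - 1), sq_nonneg (z i + 1)]
  have h2 : (1 + 1 / ε) * (z ⬝ᵥ z + ε) = z ⬝ᵥ z + ε + (z ⬝ᵥ z) / ε + 1 := by
    field_simp; ring
  have : 0 ≤ z ⬝ᵥ z / ε := by positivity
  linarith

lemma abs_coord_deriv_le (hε : 0 < ε) (z : Fin d → ℝ) (i : Fin d) :
    |1 / (z ⬝ᵥ z + ε) - 2 * z i ^ 2 / (z ⬝ᵥ z + ε) ^ 2| ≤ 3 / ε := by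
  have hs := real_dotProduct_self_nonneg z
  have hi := sq_le_dotProduct_self z i
  have hp : 0 < z ⬝ᵥ z + ε := by positivity
  have h1 : 1 / (z ⬝ᵥ z + ε) ≤ 1 / ε := one_div_le_one_div_of_le hε (by linarith)
  have h2 : 2 * z i ^ 2 / (z ⬝ᵥ z + ε) ^ 2 ≤ 2 * (1 / (z ⬝ᵥ z + ε)) := by
    rw [div_le_iff₀ (by positivity)]
    have : 2 * (1 / (z ⬝ᵥ z + ε)) * (z ⬝ᵥ z + ε) ^ 2 = 2 * (z ⬝ᵥ z + ε) := by field_simp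
    linarith
  have h3 : 0 ≤ 2 * z i ^ 2 / (z ⬝ᵥ z + ε) ^ 2 := by positivity
  have h4 : 0 < 1 / (z ⬝ᵥ z + ε) := by positivity
  have h5 : 3 / ε = 3 * (1 / ε) := by ring
  rw [abs_le, h5]
  constructor <;> linarith

lemma integral_coord_mul_div (hε : 0 < ε) (i : Fin d) :
    ∫ z, (z i - m i) * (z i / (z ⬝ᵥ z + ε)) ∂piGaussian m =
      ∫ z, (1 / (z ⬝ᵥ z + ε) - 2 * z i ^ 2 / (z ⬝ᵥ z + ε) ^ 2) ∂piGaussian m := by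
  have hm := measurable_dotProduct_self (d := d)
  refine integral_sub_mul_piGaussian m i (by fun_prop) (by fun_prop) (fun z t => ?_)
    (fun z => abs_coord_div_le hε z i) (fun z => abs_coord_deriv_le hε z i)
  simp only [dotProduct_update_self, Function.update_self]
  have hr := sq_le_dotProduct_self z i
  have hp : 0 < t ^ 2 + (z ⬝ᵥ z - z i ^ 2) + ε := by nlinarith [sq_nonneg t]
  have h1 : HasDerivAt (fun t : ℝ => t ^ 2 + (z ⬝ᵥ z - z i ^ 2) + ε) (2 * t) t := by
    simpa using (((hasDerivAt_id t).pow 2).add_const (z ⬝ᵥ z - z i ^ 2)).add_const ε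
  exact ((hasDerivAt_id t).div h1 hp.ne').congr_deriv (by simp only [id]; field_simp)

lemma abs_sub_dotProduct_div_le (hε : 0 ≤ ε) (z : Fin d → ℝ) (hz : 0 < z ⬝ᵥ z + ε) :
    |(z - m) ⬝ᵥ z / (z ⬝ᵥ z + ε)| ≤ 1 + m ⬝ᵥ m / 2 + 1 / (z ⬝ᵥ z + ε) / 2 := by
  have hs := real_dotProduct_self_nonneg z
  set s := z ⬝ᵥ z with hsd
  set u := 1 / (s + ε) with hu
  have hu0 : 0 < u := by positivity
  have hsu : s * u ≤ 1 := by
    rw [hu, mul_one_div, div_le_one hz]; linarith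
  have hsu0 : 0 ≤ s * u := by positivity
  have e : (z - m) ⬝ᵥ z / (s + ε) = s * u - u * (m ⬝ᵥ z) := by
    rw [sub_dotProduct, ← hsd, hu]; ring
  have key : ∀ c : ℝ, 0 ≤ m ⬝ᵥ m + 2 * c * (m ⬝ᵥ z) + c ^ 2 * s := by
    intro c
    have := real_dotProduct_self_nonneg (m + c • z)
    simp only [add_dotProduct, dotProduct_add, smul_dotProduct, dotProduct_smul, smul_eq_mul,
      dotProduct_comm z m, ← hsd] at this
    linarith
  have h1 := key u
  have h2 := key (-u)
  have h3 : u ^ 2 * s ≤ u := by nlinarith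
  rw [e, abs_le]
  constructor <;> nlinarith

lemma integrable_one_div_add (hε : 0 < ε) :
    Integrable (fun z => 1 / (z ⬝ᵥ z + ε)) (piGaussian m) := by
  have hm := measurable_dotProduct_self (d := d)
  refine Integrable.of_bound (Measurable.aestronglyMeasurable (by fun_prop)) (1 / ε)
    (ae_of_all _ fun z => ?_)
  have hs := real_dotProduct_self_nonneg z
  rw [Real.norm_of_nonneg (by positivity)]
  exact one_div_le_one_div_of_le hε (by linarith)

lemma integrable_sub_dotProduct_div (hε : 0 < ε) :
    Integrable (fun z => (z - m) ⬝ᵥ z / (z ⬝ᵥ z + ε)) (piGaussian m) := by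
  have hm := measurable_dotProduct_self (d := d)
  have hm' := measurable_sub_dotProduct m
  refine ((integrable_const (1 + m ⬝ᵥ m / 2)).add ((integrable_one_div_add m hε).div_const 2)).mono'
    (Measurable.aestronglyMeasurable (by fun_prop)) (ae_of_all _ fun z => ?_)
  have hs := real_dotProduct_self_nonneg z
  exact abs_sub_dotProduct_div_le m hε.le z (by positivity)

/-- Stein's identity for the regularized shrinkage field, after dropping a nonnegative term. -/
lemma mul_integral_one_div_add_le (hε : 0 < ε) :
    ((d : ℝ) - 2) * ∫ z, 1 / (z ⬝ᵥ z + ε) ∂piGaussian m ≤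
      ∫ z, (z - m) ⬝ᵥ z / (z ⬝ᵥ z + ε) ∂piGaussian m := by
  have hm := measurable_dotProduct_self (d := d)
  have hint : ∀ i, Integrable (fun z => (z i - m i) * (z i / (z ⬝ᵥ z + ε))) (piGaussian m) :=
    fun i => (((memLp_eval_piGaussian m i).integrable (by norm_num)).sub
      (integrable_const _)).mul_bdd (Measurable.aestronglyMeasurable (by fun_prop))
      (ae_of_all _ fun z => abs_coord_div_le hε z i)
  have hint' : ∀ i, Integrable (fun z => 1 / (z ⬝ᵥ z + ε) - 2 * z i ^ 2 / (z ⬝ᵥ z + ε) ^ 2)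
      (piGaussian m) := fun i =>
    Integrable.of_bound (Measurable.aestronglyMeasurable (by fun_prop)) (3 / ε)
      (ae_of_all _ fun z => abs_coord_deriv_le hε z i)
  have e1 : ∫ z, (z - m) ⬝ᵥ z / (z ⬝ᵥ z + ε) ∂piGaussian m =
      ∫ z, ∑ i, (1 / (z ⬝ᵥ z + ε) - 2 * z i ^ 2 / (z ⬝ᵥ z + ε) ^ 2) ∂piGaussian m := by
    rw [integral_finsetSum _ fun i _ => hint' i]
    simp_rw [← integral_coord_mul_div m hε]
    rw [← integral_finsetSum _ fun i _ => hint i]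
    congr 1
    ext z
    simp [dotProduct, Finset.sum_div, mul_div_assoc]
  rw [e1, ← integral_const_mul]
  refine integral_mono ((integrable_one_div_add m hε).const_mul _)
    (integrable_finsetSum _ fun i _ => hint' i) fun z => ?_
  have hs := real_dotProduct_self_nonneg z
  have hp : 0 < z ⬝ᵥ z + ε := by positivity
  have e2 : ∑ i, 2 * z i ^ 2 / (z ⬝ᵥ z + ε) ^ 2 = 2 * (z ⬝ᵥ z) / (z ⬝ᵥ z + ε) ^ 2 := by
    rw [← Finset.sum_div, ← Finset.mul_sum]
    simp [dotProduct, sq]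
  have h2 : 2 * (z ⬝ᵥ z) / (z ⬝ᵥ z + ε) ^ 2 ≤ 2 * (1 / (z ⬝ᵥ z + ε)) := by
    rw [div_le_iff₀ (by positivity)]
    have : 2 * (1 / (z ⬝ᵥ z + ε)) * (z ⬝ᵥ z + ε) ^ 2 = 2 * (z ⬝ᵥ z + ε) := by field_simp
    linarith
  simp only [Finset.sum_sub_distrib, e2, Finset.sum_const, Finset.card_univ, Fintype.card_fin,
    nsmul_eq_mul]
  linarith

lemma integral_one_div_add_le (hd : 2 < d) (hε : 0 < ε) :
    ∫ z, 1 / (z ⬝ᵥ z + ε) ∂piGaussian m ≤ 2 + m ⬝ᵥ m := by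
  have h1 := mul_integral_one_div_add_le m hε
  have h2 : ∫ z, (z - m) ⬝ᵥ z / (z ⬝ᵥ z + ε) ∂piGaussian m ≤
      ∫ z, ((1 + m ⬝ᵥ m / 2) + 1 / (z ⬝ᵥ z + ε) / 2) ∂piGaussian m := by
    refine integral_mono (integrable_sub_dotProduct_div m hε)
      ((integrable_const _).add ((integrable_one_div_add m hε).div_const 2)) fun z => ?_
    have hs := real_dotProduct_self_nonneg z
    exact (le_abs_self _).trans (abs_sub_dotProduct_div_le m hε.le z (by positivity))
  rw [integral_add (integrable_const _) ((integrable_one_div_add m hε).div_const 2),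
    integral_div] at h2
  simp only [integral_const, probReal_univ, one_smul] at h2
  have h3 : 0 ≤ ∫ z, 1 / (z ⬝ᵥ z + ε) ∂piGaussian m := integral_nonneg fun z => by
    have hs := real_dotProduct_self_nonneg z
    positivity
  have h4 : (3 : ℝ) ≤ d := by exact_mod_cast hd
  nlinarith

end Regularized

section Limit

variable {d : ℕ} (m : Fin d → ℝ)

lemma tendsto_add_one_div_nat (s : ℝ) :
    Filter.Tendsto (fun n : ℕ => s + 1 / ((n : ℝ) + 1)) Filter.atTop (nhds s) := by
  simpa using tendsto_one_div_add_atTop_nhds_zero_nat.const_add s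

/-- The inverse squared norm of a Gaussian vector is integrable in dimension at least three. -/
lemma integrable_one_div_dotProduct_self (hd : 2 < d) :
    Integrable (fun z => 1 / (z ⬝ᵥ z)) (piGaussian m) := by
  have hm := measurable_dotProduct_self (d := d)
  have hlim : ∀ᵐ z ∂piGaussian m, Filter.Tendsto
      (fun n : ℕ => 1 / (z ⬝ᵥ z + 1 / ((n : ℝ) + 1))) Filter.atTop (nhds (1 / (z ⬝ᵥ z))) := by
    filter_upwards [ae_dotProduct_self_pos_piGaussian (by omega) m] with z hz
    exact tendsto_const_nhds.div (tendsto_add_one_div_nat _) hz.ne'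
  refine ⟨Measurable.aestronglyMeasurable (by fun_prop), ?_⟩
  have hle : ∫⁻ z, ‖1 / (z ⬝ᵥ z)‖ₑ ∂piGaussian m ≤ Filter.liminf
      (fun n : ℕ => ∫⁻ z, ‖1 / (z ⬝ᵥ z + 1 / ((n : ℝ) + 1))‖ₑ ∂piGaussian m) Filter.atTop := by
    refine le_trans (le_of_eq (lintegral_congr_ae ?_))
      (lintegral_liminf_le fun n => Measurable.enorm (by fun_prop))
    filter_upwards [hlim] with z hz using hz.enorm.liminf_eq.symm
  refine lt_of_le_of_lt hle (lt_of_le_of_lt (b := ENNReal.ofReal (2 + m ⬝ᵥ m)) ?_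
    ENNReal.ofReal_lt_top)
  refine Filter.liminf_le_of_le (by isBoundedDefault) fun b hb => ?_
  obtain ⟨n, hn⟩ := hb.exists
  have hε : (0 : ℝ) < 1 / ((n : ℝ) + 1) := by positivity
  refine hn.trans ?_
  rw [← ofReal_integral_norm_eq_lintegral_enorm (integrable_one_div_add m hε)]
  refine ENNReal.ofReal_le_ofReal (le_trans (le_of_eq ?_) (integral_one_div_add_le m hd hε))
  congr 1
  ext z
  have hs := real_dotProduct_self_nonneg z
  exact Real.norm_of_nonneg (by positivity)

lemma integrable_sub_dotProduct_div_self (hd : 2 < d) :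
    Integrable (fun z => (z - m) ⬝ᵥ z / (z ⬝ᵥ z)) (piGaussian m) := by
  have hm := measurable_dotProduct_self (d := d)
  have hm' := measurable_sub_dotProduct m
  refine ((integrable_const (1 + m ⬝ᵥ m / 2)).add
    ((integrable_one_div_dotProduct_self m hd).div_const 2)).mono'
    (Measurable.aestronglyMeasurable (by fun_prop)) ?_
  filter_upwards [ae_dotProduct_self_pos_piGaussian (by omega) m] with z hz
  have := abs_sub_dotProduct_div_le m le_rfl z (by simpa using hz)
  rwa [add_zero] at this

lemma mul_integral_one_div_dotProduct_self_le (hd : 2 < d) :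
    ((d : ℝ) - 2) * ∫ z, 1 / (z ⬝ᵥ z) ∂piGaussian m ≤
      ∫ z, (z - m) ⬝ᵥ z / (z ⬝ᵥ z) ∂piGaussian m := by
  have hm := measurable_dotProduct_self (d := d)
  have hm' := measurable_sub_dotProduct m
  have hpos := ae_dotProduct_self_pos_piGaussian (by omega) m
  have hi := integrable_one_div_dotProduct_self m hd
  have hbd : ∀ (z : Fin d → ℝ), 0 < z ⬝ᵥ z → ∀ n : ℕ,
      1 / (z ⬝ᵥ z + 1 / ((n : ℝ) + 1)) ≤ 1 / (z ⬝ᵥ z) := fun z hz n =>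
    one_div_le_one_div_of_le hz (le_add_of_nonneg_right (by positivity))
  have t1 : Filter.Tendsto
      (fun n : ℕ => ∫ z, 1 / (z ⬝ᵥ z + 1 / ((n : ℝ) + 1)) ∂piGaussian m) Filter.atTop
      (nhds (∫ z, 1 / (z ⬝ᵥ z) ∂piGaussian m)) := by
    refine tendsto_integral_of_dominated_convergence _
      (fun n => Measurable.aestronglyMeasurable (by fun_prop)) hi (fun n => ?_) ?_
    · filter_upwards [hpos] with z hz
      rw [Real.norm_of_nonneg (by positivity)]
      exact hbd z hz n
    · filter_upwards [hpos] with z hz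
      exact tendsto_const_nhds.div (tendsto_add_one_div_nat _) hz.ne'
  have t2 : Filter.Tendsto
      (fun n : ℕ => ∫ z, (z - m) ⬝ᵥ z / (z ⬝ᵥ z + 1 / ((n : ℝ) + 1)) ∂piGaussian m) Filter.atTop
      (nhds (∫ z, (z - m) ⬝ᵥ z / (z ⬝ᵥ z) ∂piGaussian m)) := by
    refine tendsto_integral_of_dominated_convergence _
      (fun n => Measurable.aestronglyMeasurable (by fun_prop))
      ((integrable_const (1 + m ⬝ᵥ m / 2)).add (hi.div_const 2)) (fun n => ?_) ?_
    · filter_upwards [hpos] with z hz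
      have := abs_sub_dotProduct_div_le m (ε := 1 / ((n : ℝ) + 1)) (by positivity) z (by positivity)
      have h2 := hbd z hz n
      rw [Real.norm_eq_abs, Pi.add_apply]
      linarith
    · filter_upwards [hpos] with z hz
      exact tendsto_const_nhds.div (tendsto_add_one_div_nat _) hz.ne'
  exact le_of_tendsto_of_tendsto' (t1.const_mul _) t2 fun n =>
    mul_integral_one_div_add_le m (by positivity)

lemma integrable_sub_sq_piGaussian (i : Fin d) :
    Integrable (fun z => (z i - m i) ^ 2) (piGaussian m) :=
  ((memLp_eval_piGaussian m i).sub (memLp_const (m i))).integrable_sq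

lemma integrable_sub_dotProduct_self :
    Integrable (fun z => (z - m) ⬝ᵥ (z - m)) (piGaussian m) := by
  simp only [dotProduct, Pi.sub_apply, ← sq]
  exact integrable_finsetSum _ fun i _ => integrable_sub_sq_piGaussian m i

lemma integral_sub_dotProduct_self :
    ∫ z, (z - m) ⬝ᵥ (z - m) ∂piGaussian m = d := by
  simp only [dotProduct, Pi.sub_apply, ← sq]
  rw [integral_finsetSum _ fun i _ => integrable_sub_sq_piGaussian m i]
  have : ∀ i, ∫ z, (z i - m i) ^ 2 ∂piGaussian m = 1 := by
    intro i
    have hv := variance_fun_id_gaussianReal (μ := m i) (v := 1)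
    rw [variance_eq_integral (by fun_prop), integral_id_gaussianReal] at hv
    rw [← (measurePreserving_eval_piGaussian m i).map_eq, integral_map
      (measurable_pi_apply i).aemeasurable (by fun_prop)] at hv
    simpa using hv
  simp [this]

/-- The James–Stein estimator has risk smaller than `d` under `N(m, I)`. -/
lemma integral_jamesStein_lt (hd : 2 < d) :
    ∫ z, ((1 - ((d : ℝ) - 2) / (z ⬝ᵥ z)) • z - m) ⬝ᵥ
      ((1 - ((d : ℝ) - 2) / (z ⬝ᵥ z)) • z - m) ∂piGaussian m < d := by
  have hi := integrable_one_div_dotProduct_self m hd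
  have hi2 := integrable_sub_dotProduct_div_self m hd
  have hi3 := integrable_sub_dotProduct_self m
  have e : ∀ z : Fin d → ℝ, ((1 - ((d : ℝ) - 2) / (z ⬝ᵥ z)) • z - m) ⬝ᵥ
      ((1 - ((d : ℝ) - 2) / (z ⬝ᵥ z)) • z - m) = (z - m) ⬝ᵥ (z - m)
        - 2 * ((d : ℝ) - 2) * ((z - m) ⬝ᵥ z / (z ⬝ᵥ z))
        + ((d : ℝ) - 2) ^ 2 * (1 / (z ⬝ᵥ z)) := by
    intro z
    by_cases hz : z = 0
    · simp [hz]
    have hz' : z ⬝ᵥ z ≠ 0 := by simpa using hz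
    simp only [sub_dotProduct, dotProduct_sub, smul_dotProduct, dotProduct_smul, smul_eq_mul,
      dotProduct_comm z m]
    field_simp
    ring
  simp_rw [e]
  have hi4 : Integrable (fun z => (z - m) ⬝ᵥ (z - m)
      - 2 * ((d : ℝ) - 2) * ((z - m) ⬝ᵥ z / (z ⬝ᵥ z))) (piGaussian m) := hi3.sub (hi2.const_mul _)
  rw [integral_add hi4 (hi.const_mul _),
    integral_sub hi3 (hi2.const_mul _), integral_const_mul, integral_const_mul,
    integral_sub_dotProduct_self]
  have hle := mul_integral_one_div_dotProduct_self_le m hd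
  have hpos : 0 < ∫ z, 1 / (z ⬝ᵥ z) ∂piGaussian m := by
    have hae := ae_dotProduct_self_pos_piGaussian (by omega) m
    rw [integral_pos_iff_support_of_nonneg
      (fun z => one_div_nonneg.2 (real_dotProduct_self_nonneg z)) hi]
    have : Function.support (fun z : Fin d → ℝ => 1 / (z ⬝ᵥ z)) =ᵐ[piGaussian m] Set.univ := by
      rw [Filter.eventuallyEq_univ]
      filter_upwards [hae] with z hz
      simpa using fun h : z = 0 => hz.ne' (by simp [h])
    rw [measure_congr this]
    simp
  have hd' : (0 : ℝ) < d - 2 := by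
    have : (2 : ℝ) < d := by exact_mod_cast hd
    linarith
  have := mul_le_mul_of_nonneg_left hle hd'.le
  have := mul_pos (pow_pos hd' 2) hpos
  nlinarith

end Limit

section Whitening

variable {Ω : Type*} [MeasurableSpace Ω] {μ : Measure Ω} {d : ℕ}

lemma HasGaussianLaw.aemeasurable_dotProduct {X : Ω → Fin d → ℝ} {m : Fin d → ℝ}
    {C : Matrix (Fin d) (Fin d) ℝ} (h : _root_.HasGaussianLaw μ X m C) (a : Fin d → ℝ) :
    AEMeasurable (fun ω => a ⬝ᵥ X ω) μ := by
  by_contra hn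
  have h1 := h a
  rw [Measure.map_of_not_aemeasurable hn] at h1
  exact IsProbabilityMeasure.ne_zero _ h1.symm

lemma HasGaussianLaw.aemeasurable {X : Ω → Fin d → ℝ} {m : Fin d → ℝ}
    {C : Matrix (Fin d) (Fin d) ℝ} (h : _root_.HasGaussianLaw μ X m C) : AEMeasurable X μ :=
  aemeasurable_pi_lambda _ fun i => by simpa using h.aemeasurable_dotProduct (Pi.single i 1)

lemma HasGaussianLaw.mulVec {X : Ω → Fin d → ℝ} {m : Fin d → ℝ}
    {C : Matrix (Fin d) (Fin d) ℝ} (h : _root_.HasGaussianLaw μ X m C)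
    (B : Matrix (Fin d) (Fin d) ℝ) :
    _root_.HasGaussianLaw μ (fun ω => B *ᵥ X ω) (B *ᵥ m) (B * C * Bᵀ) := by
  intro a
  simpa [dotProduct_mulVec, ← mulVec_mulVec, ← mulVec_transpose, Matrix.mul_assoc] using h (a ᵥ* B)

/-- A Gaussian vector with identity covariance has independent coordinates. -/
lemma HasGaussianLaw.map_eq_piGaussian {X : Ω → Fin d → ℝ} {m : Fin d → ℝ}
    [IsProbabilityMeasure μ] (h : _root_.HasGaussianLaw μ X m 1) : μ.map X = piGaussian m := by
  have hX := h.aemeasurable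
  have := Measure.isProbabilityMeasure_map (μ := μ) hX
  refine charFun_eq_pi_iff.1 fun t => ?_
  have h1 : charFun ((μ.map X).map (WithLp.toLp 2)) t =
      charFun (μ.map fun ω => WithLp.ofLp t ⬝ᵥ X ω) 1 := by
    rw [charFun_apply, charFun_apply, integral_map (by fun_prop) (by fun_prop),
      integral_map hX (by fun_prop), integral_map (h.aemeasurable_dotProduct _) (by fun_prop)]
    simp [PiLp.inner_apply, dotProduct, mul_comm]
  rw [h1, h, charFun_gaussianReal]
  simp_rw [charFun_gaussianReal]
  rw [← Complex.exp_sum]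
  congr 1
  have hnn := real_dotProduct_self_nonneg (WithLp.ofLp t)
  simp [one_mulVec, hnn, Finset.sum_sub_distrib]
  simp [dotProduct, Finset.sum_div, Finset.sum_mul, sq]

end Whitening

open scoped MatrixOrder ComplexOrder in
lemma Matrix.PosDef.exists_inv_eq_transpose_mul_self {d : ℕ}
    {S : Matrix (Fin d) (Fin d) ℝ} (hS : S.PosDef) :
    ∃ B : Matrix (Fin d) (Fin d) ℝ, S⁻¹ = Bᵀ * B ∧ B * S * Bᵀ = 1 := by
  obtain ⟨B, hB⟩ := CStarAlgebra.nonneg_iff_eq_star_mul_self.mp hS.inv.posSemidef.nonneg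
  have hB' : S⁻¹ = Bᵀ * B := by simpa [star_eq_conjTranspose] using hB
  refine ⟨B, hB', ?_⟩
  have h1 : Bᵀ * (B * S) = 1 := by
    rw [← Matrix.mul_assoc, ← hB', Matrix.nonsing_inv_mul _
      ((Matrix.isUnit_iff_isUnit_det _).1 hS.isUnit)]
  exact mul_eq_one_comm.1 h1

/-- For `d > 2` the James–Stein estimator `θ̂(X) = (1 - (d-2)/(XᵀSig⁻¹X)) X` satisfies
`E[(θ̂-θ)ᵀSig⁻¹(θ̂-θ)] < d = E[(X-θ)ᵀSig⁻¹(X-θ)]` for every `θ`: it strictly dominates `X`. -/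
theorem stmt_9 {d : ℕ} (hd : 2 < d) {Ω : Type*} [MeasurableSpace Ω]
    (μ : Measure Ω) [IsProbabilityMeasure μ]
    (Sig : Matrix (Fin d) (Fin d) ℝ) (hSig : Sig.PosDef) :
    ∀ (θ : Fin d → ℝ) (X : Ω → Fin d → ℝ), HasGaussianLaw μ X θ Sig →
    ∀ θhat : Ω → Fin d → ℝ,
      (∀ ω, θhat ω = (1 - ((d : ℝ) - 2) / (X ω ⬝ᵥ (Sig⁻¹ *ᵥ X ω))) • X ω) →
      (∫ ω, (θhat ω - θ) ⬝ᵥ (Sig⁻¹ *ᵥ (θhat ω - θ)) ∂μ < (d : ℝ)) ∧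
      (∫ ω, (X ω - θ) ⬝ᵥ (Sig⁻¹ *ᵥ (X ω - θ)) ∂μ = (d : ℝ)) := by
  intro θ X hX θhat hθ
  obtain ⟨B, hB, hB1⟩ := hSig.exists_inv_eq_transpose_mul_self
  have hZ := hX.mulVec B
  rw [hB1] at hZ
  have hmap := hZ.map_eq_piGaussian
  have hq : ∀ v : Fin d → ℝ, v ⬝ᵥ (Sig⁻¹ *ᵥ v) = (B *ᵥ v) ⬝ᵥ (B *ᵥ v) := by
    intro v
    rw [hB, ← mulVec_mulVec, dotProduct_mulVec, vecMul_transpose]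
  simp only [hθ, hq]
  simp only [mulVec_sub, mulVec_smul]
  have hm := measurable_dotProduct_self (d := d)
  constructor
  · have := integral_jamesStein_lt (B *ᵥ θ) hd
    rwa [← hmap, integral_map hZ.aemeasurable] at this
    exact (hm.comp (by fun_prop : Measurable fun z : Fin d → ℝ =>
      (1 - ((d : ℝ) - 2) / (z ⬝ᵥ z)) • z - B *ᵥ θ)).aestronglyMeasurable
  · have := integral_sub_dotProduct_self (B *ᵥ θ)
    rwa [← hmap, integral_map hZ.aemeasurable] at this
    exact (hm.comp (by fun_prop : Measurable fun z : Fin d → ℝ =>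
      z - B *ᵥ θ)).aestronglyMeasurable
end
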